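/- Fix an integer N ≥ 1 and a real number p > 1. The ODE blow-up profile κ₀ is mode stable: if λ ∈ ℂ is an eigenvalue of the linearized operator around κ₀ (i.e. the eigen-equation for (0, λ) admits a solution smooth on the closed unit ball of ℝ^N and not identically zero there) and Re λ > −1, then λ = 0 or λ = 1. -/

import Mathlib

open scoped RealInnerProductSpace

noncomputable section

/-- The constant `κ₀ = (2(p+1)/(p-1)²)^{1/(p-1)}`. -/
def kappa0 (p : ℝ) : ℝ := (2 * (p + 1) / (p - 1) ^ 2) ^ (1 / (p - 1))

/-- The boosted self-similar profile `κ_d(y) = κ₀ (1-|d|²)^{1/(p-1)} (1+d⬝y)^{-2/(p-1)}`. -/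
def kd {N : ℕ} (p : ℝ) (d y : EuclideanSpace ℝ (Fin N)) : ℝ :=
  kappa0 p * (1 - ‖d‖ ^ 2) ^ (1 / (p - 1)) * (1 + ⟪d, y⟫) ^ (-(2 / (p - 1)))

/-- Partial derivative of a real-valued function in the `i`-th coordinate direction. -/
def pd {N : ℕ} (i : Fin N) (f : EuclideanSpace ℝ (Fin N) → ℝ)
    (y : EuclideanSpace ℝ (Fin N)) : ℝ :=
  fderiv ℝ f y (EuclideanSpace.single i 1)

/-- Derivative in the first (time) variable. -/
def dT {N : ℕ} (u : ℝ × EuclideanSpace ℝ (Fin N) → ℝ) (t : ℝ)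
    (x : EuclideanSpace ℝ (Fin N)) : ℝ := deriv (fun t' => u (t', x)) t

/-- Second derivative in the first (time) variable. -/
def dTT {N : ℕ} (u : ℝ × EuclideanSpace ℝ (Fin N) → ℝ) (t : ℝ)
    (x : EuclideanSpace ℝ (Fin N)) : ℝ := deriv (fun t' => dT u t' x) t

/-- Spatial Laplacian. -/
def lapX {N : ℕ} (u : ℝ × EuclideanSpace ℝ (Fin N) → ℝ) (t : ℝ)
    (x : EuclideanSpace ℝ (Fin N)) : ℝ :=
  ∑ i : Fin N, pd i (pd i (fun z => u (t, z))) x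

/-- `u` satisfies `∂ₜₜu − Δₓu = |u|^{p−1}u` at the point `q = (t, x)`. -/
def WaveEqAt {N : ℕ} (p : ℝ) (u : ℝ × EuclideanSpace ℝ (Fin N) → ℝ)
    (q : ℝ × EuclideanSpace ℝ (Fin N)) : Prop :=
  dTT u q.1 q.2 - lapX u q.1 q.2 = |u q| ^ (p - 1) * u q

/-- `U` satisfies the self-similar wave equation at `(s, y)`. -/
def SSat {N : ℕ} (p : ℝ) (U : ℝ × EuclideanSpace ℝ (Fin N) → ℝ) (s : ℝ)
    (y : EuclideanSpace ℝ (Fin N)) : Prop :=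
  dTT U s y + (p + 3) / (p - 1) * dT U s y
    + 2 * (∑ i : Fin N, y i * pd i (fun z => dT U s z) y)
    + 2 * (p + 1) / (p - 1) * (∑ i : Fin N, y i * pd i (fun z => U (s, z)) y)
    + (∑ i : Fin N, ∑ j : Fin N,
        (y i * y j - if i = j then (1 : ℝ) else 0) * pd i (pd j (fun z => U (s, z))) y)
    + 2 * (p + 1) / (p - 1) ^ 2 * U (s, y)
    = |U (s, y)| ^ (p - 1) * U (s, y)

/-- `η` satisfies the linearized self-similar equation with potential `V` at `(s, y)`. -/
def LinEqAt {N : ℕ} (p : ℝ) (V : EuclideanSpace ℝ (Fin N) → ℝ)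
    (η : ℝ × EuclideanSpace ℝ (Fin N) → ℝ) (s : ℝ)
    (y : EuclideanSpace ℝ (Fin N)) : Prop :=
  dTT η s y + (p + 3) / (p - 1) * dT η s y
    + 2 * (∑ i : Fin N, y i * pd i (fun z => dT η s z) y)
    + 2 * (p + 1) / (p - 1) * (∑ i : Fin N, y i * pd i (fun z => η (s, z)) y)
    + (∑ i : Fin N, ∑ j : Fin N,
        (y i * y j - if i = j then (1 : ℝ) else 0) * pd i (pd j (fun z => η (s, z))) y)
    + (2 * (p + 1) / (p - 1) ^ 2 - V y) * η (s, y) = 0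

/-- The Lorentz boost `Λ_β(t,x) = (γ(t − β⬝x), x − γβt + (γ²(β⬝x)/(1+γ))β)`,
with `γ = (1−|β|²)^{−1/2}`. -/
def boost {N : ℕ} (β : EuclideanSpace ℝ (Fin N)) (q : ℝ × EuclideanSpace ℝ (Fin N)) :
    ℝ × EuclideanSpace ℝ (Fin N) :=
  (((1 - ‖β‖ ^ 2) ^ (-(1 / 2) : ℝ)) * (q.1 - ⟪β, q.2⟫),
    q.2 - (((1 - ‖β‖ ^ 2) ^ (-(1 / 2) : ℝ)) * q.1) • β
      + ((((1 - ‖β‖ ^ 2) ^ (-(1 / 2) : ℝ)) ^ 2 * ⟪β, q.2⟫)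
          / (1 + (1 - ‖β‖ ^ 2) ^ (-(1 / 2) : ℝ))) • β)

/-- The spatial map `y' ↦ (y' − γβ + (γ²(β⬝y')/(1+γ))β) / (γ(1 − β⬝y'))` of the
Lorentz transform in self-similar variables. -/
def ymap {N : ℕ} (β y' : EuclideanSpace ℝ (Fin N)) : EuclideanSpace ℝ (Fin N) :=
  (((1 - ‖β‖ ^ 2) ^ (-(1 / 2) : ℝ)) * (1 - ⟪β, y'⟫))⁻¹
    • (y' - ((1 - ‖β‖ ^ 2) ^ (-(1 / 2) : ℝ)) • β
        + ((((1 - ‖β‖ ^ 2) ^ (-(1 / 2) : ℝ)) ^ 2 * ⟪β, y'⟫)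
            / (1 + (1 - ‖β‖ ^ 2) ^ (-(1 / 2) : ℝ))) • β)

/-- The Lorentz transform `𝒯_β` in self-similar variables:
`(𝒯_β U)(s',y') = (γ(1 − β⬝y'))^{−2/(p−1)} U(s' − log(1 − β⬝y'), ymap β y')`. -/
def lorentzSS {N : ℕ} (p : ℝ) (β : EuclideanSpace ℝ (Fin N))
    (U : ℝ × EuclideanSpace ℝ (Fin N) → ℝ) (q : ℝ × EuclideanSpace ℝ (Fin N)) : ℝ :=
  (((1 - ‖β‖ ^ 2) ^ (-(1 / 2) : ℝ)) * (1 - ⟪β, q.2⟫)) ^ (-(2 / (p - 1)))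
    * U (q.1 - Real.log (1 - ⟪β, q.2⟫), ymap β q.2)

/-- Partial derivative of a complex-valued function in the `i`-th coordinate direction. -/
def pdC {N : ℕ} (i : Fin N) (f : EuclideanSpace ℝ (Fin N) → ℂ)
    (y : EuclideanSpace ℝ (Fin N)) : ℂ :=
  fderiv ℝ f y (EuclideanSpace.single i 1)

/-- The eigen-equation for `(d, λ)` at a point `y`. -/
def EigenEqAt {N : ℕ} (p : ℝ) (d : EuclideanSpace ℝ (Fin N)) (lam : ℂ)
    (φ : EuclideanSpace ℝ (Fin N) → ℂ) (y : EuclideanSpace ℝ (Fin N)) : Prop :=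
  (lam ^ 2 + (((p + 3) / (p - 1) : ℝ) : ℂ) * lam + ((2 * (p + 1) / (p - 1) ^ 2 : ℝ) : ℂ)
      - ((p * kd p d y ^ (p - 1) : ℝ) : ℂ)) * φ y
    + (2 * lam + ((2 * (p + 1) / (p - 1) : ℝ) : ℂ))
        * (∑ i : Fin N, (y i : ℂ) * pdC i φ y)
    + (∑ i : Fin N, ∑ j : Fin N,
        (((y i * y j - if i = j then (1 : ℝ) else 0) : ℝ) : ℂ) * pdC i (pdC j φ) y)
    = 0

/-- `λ` is an eigenvalue of the linearized operator around `κ_d`: the eigen-equation for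
`(d, λ)` has a solution smooth on an open neighborhood of the closed unit ball that is
not identically zero on the closed unit ball. -/
def IsEigenvalue (N : ℕ) (p : ℝ) (d : EuclideanSpace ℝ (Fin N)) (lam : ℂ) : Prop :=
  ∃ φ : EuclideanSpace ℝ (Fin N) → ℂ, ∃ Ω : Set (EuclideanSpace ℝ (Fin N)),
    IsOpen Ω ∧ Metric.closedBall 0 1 ⊆ Ω ∧ ContDiffOn ℝ (⊤ : ℕ∞) φ Ω ∧
    (∀ y ∈ Metric.closedBall (0 : EuclideanSpace ℝ (Fin N)) 1, EigenEqAt p d lam φ y) ∧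
    ∃ y ∈ Metric.closedBall (0 : EuclideanSpace ℝ (Fin N)) 1, φ y ≠ 0


/-! ### Weight function -/

lemma wt_hasDerivAt {γ : ℝ} (hγ : 1 < γ) (t : ℝ) :
    HasDerivAt (fun x : ℝ => (max x 0) ^ γ) (γ * (max t 0) ^ (γ - 1)) t := by
  have h0 : γ ≠ 0 := by linarith
  have h1 : γ - 1 ≠ 0 := by linarith
  rcases lt_trichotomy t 0 with h | h | h
  · have : (fun x : ℝ => (max x 0) ^ γ) =ᶠ[nhds t] fun _ => 0 := by
      filter_upwards [Iio_mem_nhds h] with x hx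
      rw [max_eq_right (le_of_lt hx), Real.zero_rpow h0]
    rw [max_eq_right h.le, Real.zero_rpow h1, mul_zero]
    exact (hasDerivAt_const t (0 : ℝ)).congr_of_eventuallyEq this
  · subst h
    have e : γ * (max (0 : ℝ) 0) ^ (γ - 1) = 0 := by
      rw [max_self, Real.zero_rpow h1, mul_zero]
    rw [e, ← hasDerivWithinAt_univ, ← Set.Iic_union_Ici (a := (0 : ℝ))]
    refine HasDerivWithinAt.union ?_ ?_
    · refine (hasDerivWithinAt_const (0 : ℝ) _ (0 : ℝ)).congr ?_ ?_
      · intro x hx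
        show (max x 0) ^ γ = 0
        rw [max_eq_right hx, Real.zero_rpow h0]
      · show (max (0 : ℝ) 0) ^ γ = 0
        rw [max_self, Real.zero_rpow h0]
    · have := (Real.hasDerivAt_rpow_const (x := 0) (p := γ) (Or.inr hγ.le)).hasDerivWithinAt
        (s := Set.Ici 0)
      rw [Real.zero_rpow h1, mul_zero] at this
      refine this.congr ?_ ?_
      · intro x hx
        show (max x 0) ^ γ = x ^ γ
        rw [max_eq_left hx]
      · show (max (0 : ℝ) 0) ^ γ = 0 ^ γ
        rw [max_self]
  · have : (fun x : ℝ => (max x 0) ^ γ) =ᶠ[nhds t] fun x => x ^ γ := by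
      filter_upwards [Ioi_mem_nhds h] with x hx
      rw [max_eq_left (le_of_lt hx)]
    rw [max_eq_left h.le]
    exact (Real.hasDerivAt_rpow_const (Or.inl h.ne')).congr_of_eventuallyEq this

lemma wt_contDiff {γ : ℝ} (hγ : 1 < γ) : ContDiff ℝ 1 (fun x : ℝ => (max x 0) ^ γ) := by
  rw [contDiff_one_iff_deriv]
  refine ⟨fun t => (wt_hasDerivAt hγ t).differentiableAt, ?_⟩
  have : deriv (fun x : ℝ => (max x 0) ^ γ) = fun t => γ * (max t 0) ^ (γ - 1) :=
    funext fun t => (wt_hasDerivAt hγ t).deriv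
  rw [this]
  refine continuous_const.mul ((continuous_id.max continuous_const).rpow_const ?_)
  intro x; right; linarith

lemma integral_fderiv_zero {N : ℕ} (W : EuclideanSpace ℝ (Fin N) → ℂ) (hW : ContDiff ℝ 1 W)
    (hc : HasCompactSupport W) (v : EuclideanSpace ℝ (Fin N)) :
    ∫ y, fderiv ℝ W y v = 0 := by
  have hcont : Continuous fun y => fderiv ℝ W y v :=
    (hW.continuous_fderiv one_ne_zero).clm_apply continuous_const
  have hcs : HasCompactSupport fun y => fderiv ℝ W y v := hc.fderiv_apply ℝ v
  have := integral_bilinear_fderiv_right_eq_neg_left_of_integrable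
    (μ := MeasureTheory.volume) (f := fun _ : EuclideanSpace ℝ (Fin N) => (1 : ℝ)) (g := W)
    (v := v) (B := ContinuousLinearMap.lsmul ℝ ℝ) (by simp)
    (by simpa using hcont.integrable_of_hasCompactSupport hcs)
    (by simpa using hW.continuous.integrable_of_hasCompactSupport hc)
    (by intro x _; fun_prop)
    (by intro x _; exact hW.differentiable one_ne_zero x)
  simpa using this

lemma sum_sq_eq {N : ℕ} (y : EuclideanSpace ℝ (Fin N)) : ‖y‖ ^ 2 = ∑ i, y i ^ 2 := by
  rw [EuclideanSpace.norm_sq_eq]; simp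

/-- Weighted divergence theorem on the unit ball, in the form of a vanishing criterion. -/
lemma weighted_div {N : ℕ} {γ : ℝ} (hγ : 1 < γ) (Q : Fin N → EuclideanSpace ℝ (Fin N) → ℂ)
    (hQ : ∀ i, ContDiff ℝ 1 (Q i))
    (hpos : ∀ y : EuclideanSpace ℝ (Fin N), ‖y‖ < 1 →
      0 ≤ (((1 - ‖y‖ ^ 2 : ℝ) : ℂ) * ∑ i, pdC i (Q i) y
        - ((2 * γ : ℝ) : ℂ) * ∑ i, (y i : ℂ) * Q i y).re)
    (y : EuclideanSpace ℝ (Fin N)) (hy : ‖y‖ < 1) :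
    (((1 - ‖y‖ ^ 2 : ℝ) : ℂ) * ∑ i, pdC i (Q i) y
        - ((2 * γ : ℝ) : ℂ) * ∑ i, (y i : ℂ) * Q i y).re = 0 := by
  set w : EuclideanSpace ℝ (Fin N) → ℝ := fun y => (max (1 - ‖y‖ ^ 2) 0) ^ γ with hw
  have hwC : ContDiff ℝ 1 w :=
    (wt_contDiff hγ).comp (contDiff_const.sub (contDiff_norm_sq ℝ))
  have hwd : ∀ (z : EuclideanSpace ℝ (Fin N)) (i : Fin N), fderiv ℝ w z (EuclideanSpace.single i 1)
      = γ * (max (1 - ‖z‖ ^ 2) 0) ^ (γ - 1) * (-(2 * z i)) := by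
    intro z i
    have h1 : HasFDerivAt (fun y : EuclideanSpace ℝ (Fin N) => 1 - ‖y‖ ^ 2)
        (-(2 • innerSL ℝ z)) z := by
      exact ((hasStrictFDerivAt_norm_sq z).hasFDerivAt).const_sub 1
    have h2 := (wt_hasDerivAt hγ (1 - ‖z‖ ^ 2)).comp_hasFDerivAt z h1
    rw [show fderiv ℝ w z = _ from h2.fderiv]
    simp [EuclideanSpace.inner_single_right]
  have hw0 : ∀ z : EuclideanSpace ℝ (Fin N), 1 ≤ ‖z‖ → max (1 - ‖z‖ ^ 2) 0 = 0 := by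
    intro z hz
    apply max_eq_right
    nlinarith
  set W : Fin N → EuclideanSpace ℝ (Fin N) → ℂ := fun i y => w y • Q i y with hWdef
  have hWC : ∀ i, ContDiff ℝ 1 (W i) := fun i => hwC.smul (hQ i)
  have hWs : ∀ i, HasCompactSupport (W i) := by
    intro i
    refine HasCompactSupport.intro (isCompact_closedBall (0 : EuclideanSpace ℝ (Fin N)) 1) ?_
    intro z hz
    have : 1 < ‖z‖ := by simpa using hz
    simp [hWdef, hw, hw0 z this.le, Real.zero_rpow (by linarith : γ ≠ 0)]
  have hWd : ∀ i z, fderiv ℝ (W i) z (EuclideanSpace.single i 1)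
      = ((max (1 - ‖z‖ ^ 2) 0 ^ γ : ℝ) : ℂ) * pdC i (Q i) z
        - ((max (1 - ‖z‖ ^ 2) 0 ^ (γ - 1) : ℝ) : ℂ) * (((2 * γ : ℝ) : ℂ) * ((z i : ℂ) * Q i z)) := by
    intro i z
    have := ((hwC.differentiable one_ne_zero z).hasFDerivAt.smul
      ((hQ i).differentiable one_ne_zero z).hasFDerivAt).fderiv
    rw [show fderiv ℝ (W i) z = _ from this]
    simp only [add_apply, smul_apply,
      ContinuousLinearMap.smulRight_apply, hwd, pdC, Complex.real_smul]
    simp only [hw]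
    push_cast
    ring
  set H : EuclideanSpace ℝ (Fin N) → ℝ :=
    fun z => (∑ i, fderiv ℝ (W i) z (EuclideanSpace.single i 1)).re with hH
  have hcontd : ∀ i, Continuous fun z => fderiv ℝ (W i) z (EuclideanSpace.single i 1) :=
    fun i => ((hWC i).continuous_fderiv one_ne_zero).clm_apply continuous_const
  have hcsd : ∀ i, HasCompactSupport fun z => fderiv ℝ (W i) z (EuclideanSpace.single i 1) :=
    fun i => (hWs i).fderiv_apply ℝ _
  have hHc : Continuous H := Complex.continuous_re.comp (continuous_finsetSum _ fun i _ => hcontd i)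
  have hin : ∀ z : EuclideanSpace ℝ (Fin N), ‖z‖ < 1 → H z = (1 - ‖z‖ ^ 2) ^ (γ - 1) *
      (((1 - ‖z‖ ^ 2 : ℝ) : ℂ) * ∑ i, pdC i (Q i) z
        - ((2 * γ : ℝ) : ℂ) * ∑ i, (z i : ℂ) * Q i z).re := by
    intro z hz
    have hp : 0 < 1 - ‖z‖ ^ 2 := by nlinarith [norm_nonneg z]
    have e : (1 - ‖z‖ ^ 2) ^ γ = (1 - ‖z‖ ^ 2) ^ (γ - 1) * (1 - ‖z‖ ^ 2) := by
      rw [Real.rpow_sub_one hp.ne']; field_simp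
    simp only [hH, hWd, max_eq_left hp.le, e]
    rw [← Complex.re_ofReal_mul, Finset.sum_sub_distrib, ← Finset.mul_sum, ← Finset.mul_sum,
      ← Finset.mul_sum]
    congr 1
    push_cast
    ring
  have hout : ∀ z : EuclideanSpace ℝ (Fin N), 1 ≤ ‖z‖ → H z = 0 := by
    intro z hz
    simp only [hH, hWd, hw0 z hz, Real.zero_rpow (by linarith : γ ≠ 0),
      Real.zero_rpow (by linarith : γ - 1 ≠ 0)]
    simp
  have hH0 : 0 ≤ H := by
    intro z
    show 0 ≤ H z
    rcases lt_or_ge ‖z‖ 1 with hz | hz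
    · rw [hin z hz]
      have hp : 0 < 1 - ‖z‖ ^ 2 := by nlinarith [norm_nonneg z]
      exact mul_nonneg (Real.rpow_nonneg hp.le _) (hpos z hz)
    · rw [hout z hz]
  have hHs : HasCompactSupport H := by
    refine HasCompactSupport.intro (isCompact_closedBall (0 : EuclideanSpace ℝ (Fin N)) 1) ?_
    intro z hz
    have : 1 < ‖z‖ := by simpa using hz
    exact hout z this.le
  have hHint : ∫ z, H z = 0 := by
    have h1 : ∫ z, ∑ i, fderiv ℝ (W i) z (EuclideanSpace.single i 1) = 0 := by
      rw [MeasureTheory.integral_finsetSum]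
      · exact Finset.sum_eq_zero fun i _ => integral_fderiv_zero _ (hWC i) (hWs i) _
      · intro i _
        exact (hcontd i).integrable_of_hasCompactSupport (hcsd i)
    have h2 : MeasureTheory.Integrable
        (fun z => ∑ i, fderiv ℝ (W i) z (EuclideanSpace.single i 1)) :=
      MeasureTheory.integrable_finsetSum _ fun i _ =>
        (hcontd i).integrable_of_hasCompactSupport (hcsd i)
    have h3 := integral_re h2
    rw [h1] at h3
    simpa [hH] using h3
  have hzero : H y = 0 := by
    by_contra hne
    have := hHc.integral_pos_of_hasCompactSupport_nonneg_nonzero (μ := MeasureTheory.volume)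
      hHs hH0 (x := y) hne
    linarith
  rw [hin y hy] at hzero
  have hp : 0 < 1 - ‖y‖ ^ 2 := by nlinarith [norm_nonneg y]
  exact (mul_eq_zero.1 hzero).resolve_left (Real.rpow_pos_of_pos hp _).ne'

/-! ### Calculus of `pdC` -/

lemma pdC_smooth {N : ℕ} {f : EuclideanSpace ℝ (Fin N) → ℂ} (hf : ContDiff ℝ (⊤ : ℕ∞) f)
    (i : Fin N) : ContDiff ℝ (⊤ : ℕ∞) (pdC i f) :=
  (hf.fderiv_right (m := (⊤ : ℕ∞)) (by exact_mod_cast le_top)).clm_apply contDiff_const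

lemma sm_diff {N : ℕ} {f : EuclideanSpace ℝ (Fin N) → ℂ} (hf : ContDiff ℝ (⊤ : ℕ∞) f) :
    Differentiable ℝ f := hf.differentiable (by simp)

lemma pdC_mul {N : ℕ} {f g : EuclideanSpace ℝ (Fin N) → ℂ} (hf : Differentiable ℝ f)
    (hg : Differentiable ℝ g) (i : Fin N) (y : EuclideanSpace ℝ (Fin N)) :
    pdC i (fun z => f z * g z) y = pdC i f y * g y + f y * pdC i g y := by
  unfold pdC
  rw [fderiv_fun_mul (hf y) (hg y)]
  simp
  ring

lemma pdC_add {N : ℕ} {f g : EuclideanSpace ℝ (Fin N) → ℂ} (hf : Differentiable ℝ f)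
    (hg : Differentiable ℝ g) (i : Fin N) (y : EuclideanSpace ℝ (Fin N)) :
    pdC i (fun z => f z + g z) y = pdC i f y + pdC i g y := by
  unfold pdC
  rw [fderiv_fun_add (hf y) (hg y)]
  simp

lemma pdC_sub {N : ℕ} {f g : EuclideanSpace ℝ (Fin N) → ℂ} (hf : Differentiable ℝ f)
    (hg : Differentiable ℝ g) (i : Fin N) (y : EuclideanSpace ℝ (Fin N)) :
    pdC i (fun z => f z - g z) y = pdC i f y - pdC i g y := by
  unfold pdC
  rw [fderiv_fun_sub (hf y) (hg y)]
  simp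

lemma pdC_const {N : ℕ} (c : ℂ) (i : Fin N) (y : EuclideanSpace ℝ (Fin N)) :
    pdC i (fun _ => c) y = 0 := by
  unfold pdC
  simp

lemma pdC_sum {N : ℕ} {f : Fin N → EuclideanSpace ℝ (Fin N) → ℂ}
    (hf : ∀ j, Differentiable ℝ (f j)) (i : Fin N) (y : EuclideanSpace ℝ (Fin N)) :
    pdC i (fun z => ∑ j, f j z) y = ∑ j, pdC i (f j) y := by
  unfold pdC
  rw [fderiv_fun_sum (fun j _ => hf j y)]
  simp

lemma coord_smooth {N : ℕ} (j : Fin N) :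
    ContDiff ℝ (⊤ : ℕ∞) (fun z : EuclideanSpace ℝ (Fin N) => ((z j : ℝ) : ℂ)) :=
  (Complex.ofRealCLM ∘L (EuclideanSpace.proj j : EuclideanSpace ℝ (Fin N) →L[ℝ] ℝ)).contDiff

lemma pdC_coord {N : ℕ} (i j : Fin N) (y : EuclideanSpace ℝ (Fin N)) :
    pdC i (fun z => ((z j : ℝ) : ℂ)) y = if i = j then 1 else 0 := by
  unfold pdC
  have := (Complex.ofRealCLM ∘L
    (EuclideanSpace.proj j : EuclideanSpace ℝ (Fin N) →L[ℝ] ℝ)).hasFDerivAt (x := y)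
  rw [show fderiv ℝ (fun z : EuclideanSpace ℝ (Fin N) => ((z j : ℝ) : ℂ)) y = _ from this.fderiv]
  simp [eq_comm]
  split_ifs <;> simp

lemma conj_smooth {N : ℕ} {f : EuclideanSpace ℝ (Fin N) → ℂ} (hf : ContDiff ℝ (⊤ : ℕ∞) f) :
    ContDiff ℝ (⊤ : ℕ∞) (fun z => (starRingEnd ℂ) (f z)) :=
  Complex.conjCLE.contDiff.comp hf

lemma pdC_conj {N : ℕ} {f : EuclideanSpace ℝ (Fin N) → ℂ} (hf : Differentiable ℝ f)
    (i : Fin N) (y : EuclideanSpace ℝ (Fin N)) :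
    pdC i (fun z => (starRingEnd ℂ) (f z)) y = (starRingEnd ℂ) (pdC i f y) := by
  unfold pdC
  have := (Complex.conjCLE.toContinuousLinearMap.hasFDerivAt (x := f y)).comp y (hf y).hasFDerivAt
  rw [show fderiv ℝ (fun z => (starRingEnd ℂ) (f z)) y = _ from this.fderiv]
  simp

lemma pdC_comm {N : ℕ} {f : EuclideanSpace ℝ (Fin N) → ℂ} (hf : ContDiff ℝ (⊤ : ℕ∞) f)
    (i j : Fin N) : pdC i (pdC j f) = pdC j (pdC i f) := by
  have key : ∀ (a b : Fin N) y, pdC a (pdC b f) y =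
      fderiv ℝ (fderiv ℝ f) y (EuclideanSpace.single a 1) (EuclideanSpace.single b 1) := by
    intro a b y
    have hd : DifferentiableAt ℝ (fderiv ℝ f) y :=
      (hf.fderiv_right (m := (⊤ : ℕ∞)) (by exact_mod_cast le_top)).differentiable (by simp) y
    have := (hd.hasFDerivAt.clm_apply (hasFDerivAt_const (EuclideanSpace.single b (1 : ℝ)) y)).fderiv
    rw [pdC, show fderiv ℝ (pdC b f) y = _ from this]
    simp
  funext y
  rw [key, key]
  have : IsSymmSndFDerivAt ℝ f y := hf.contDiffAt.isSymmSndFDerivAt (by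
    simp only [minSmoothness_of_isRCLikeNormedField]
    exact WithTop.coe_le_coe.2 (le_top : (2 : ℕ∞) ≤ ⊤))
  exact this _ _

lemma pdC_congr {N : ℕ} {f g : EuclideanSpace ℝ (Fin N) → ℂ} {y : EuclideanSpace ℝ (Fin N)}
    (h : f =ᶠ[nhds y] g) (i : Fin N) : pdC i f =ᶠ[nhds y] pdC i g := by
  filter_upwards [h.fderiv (𝕜 := ℝ)] with z hz
  simp [pdC, hz]

/-- The equation `Δφ = (E + α)(E + β)φ`, with `E = y·∇`. -/
def EqAB {N : ℕ} (α β : ℂ) (φ : EuclideanSpace ℝ (Fin N) → ℂ)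
    (y : EuclideanSpace ℝ (Fin N)) : ℂ :=
  (∑ i, ∑ j, ((y i : ℂ) * (y j : ℂ) - if i = j then 1 else 0) * pdC i (pdC j φ) y)
    + (α + β + 1) * (∑ i, (y i : ℂ) * pdC i φ y) + α * β * φ y

lemma EqAB_deriv {N : ℕ} {α β : ℂ} {φ : EuclideanSpace ℝ (Fin N) → ℂ}
    (hφ : ContDiff ℝ (⊤ : ℕ∞) φ) (k : Fin N) (y : EuclideanSpace ℝ (Fin N)) :
    pdC k (EqAB α β φ) y = EqAB (α + 1) (β + 1) (pdC k φ) y := by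
  have d0 := sm_diff hφ
  have d1 : ∀ i, Differentiable ℝ (pdC i φ) := fun i => sm_diff (pdC_smooth hφ i)
  have d2 : ∀ i j, Differentiable ℝ (pdC i (pdC j φ)) :=
    fun i j => sm_diff (pdC_smooth (pdC_smooth hφ j) i)
  have dc : ∀ j, Differentiable ℝ (fun z : EuclideanSpace ℝ (Fin N) => ((z j : ℝ) : ℂ)) :=
    fun j => sm_diff (coord_smooth j)
  have e : EqAB α β φ = fun y => (∑ i, ∑ j,
      ((y i : ℂ) * (y j : ℂ) - if i = j then 1 else 0) * pdC i (pdC j φ) y)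
    + (α + β + 1) * (∑ i, (y i : ℂ) * pdC i φ y) + α * β * φ y := rfl
  have dcc : ∀ i j : Fin N, Differentiable ℝ (fun y : EuclideanSpace ℝ (Fin N) =>
      (y i : ℂ) * (y j : ℂ) - if i = j then 1 else 0) := fun i j =>
    ((dc i).fun_mul (dc j)).fun_sub (differentiable_const _)
  have dA : ∀ i j : Fin N, Differentiable ℝ (fun y : EuclideanSpace ℝ (Fin N) =>
      ((y i : ℂ) * (y j : ℂ) - if i = j then 1 else 0) * pdC i (pdC j φ) y) := fun i j =>
    (dcc i j).fun_mul (d2 i j)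
  have dA' : ∀ i : Fin N, Differentiable ℝ (fun y : EuclideanSpace ℝ (Fin N) =>
      ∑ j, ((y i : ℂ) * (y j : ℂ) - if i = j then 1 else 0) * pdC i (pdC j φ) y) := fun i =>
    Differentiable.fun_sum fun j _ => dA i j
  have dB : ∀ i : Fin N, Differentiable ℝ (fun y : EuclideanSpace ℝ (Fin N) =>
      (y i : ℂ) * pdC i φ y) := fun i => (dc i).fun_mul (d1 i)
  have dB' : Differentiable ℝ (fun y : EuclideanSpace ℝ (Fin N) =>
      ∑ i, (y i : ℂ) * pdC i φ y) := Differentiable.fun_sum fun i _ => dB i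
  have h1 : pdC k (fun y : EuclideanSpace ℝ (Fin N) => ∑ i, ∑ j,
      ((y i : ℂ) * (y j : ℂ) - if i = j then 1 else 0) * pdC i (pdC j φ) y) y
      = (∑ i, ∑ j, ((y i : ℂ) * (y j : ℂ) - if i = j then 1 else 0) * pdC i (pdC j (pdC k φ)) y)
        + 2 * ∑ i, (y i : ℂ) * pdC i (pdC k φ) y := by
    rw [pdC_sum dA']
    have : ∀ i j, pdC k (fun y : EuclideanSpace ℝ (Fin N) =>
        ((y i : ℂ) * (y j : ℂ) - if i = j then 1 else 0) * pdC i (pdC j φ) y) y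
        = (if k = i then (y j : ℂ) * pdC j (pdC k φ) y else 0)
          + (if k = j then (y i : ℂ) * pdC i (pdC k φ) y else 0)
          + ((y i : ℂ) * (y j : ℂ) - if i = j then 1 else 0) * pdC i (pdC j (pdC k φ)) y := by
      intro i j
      rw [pdC_mul (dcc i j) (d2 i j), pdC_sub ((dc i).fun_mul (dc j)) (differentiable_const _),
        pdC_mul (dc i) (dc j), pdC_const, pdC_coord, pdC_coord, pdC_comm (pdC_smooth hφ j) k i,
        pdC_comm hφ k j]
      by_cases hi : k = i
      · subst hi
        by_cases hj : k = j
        · subst hj; simp; ring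
        · simp [hj, pdC_comm hφ k j]
      · by_cases hj : k = j
        · subst hj; simp [hi]
        · simp [hi, hj]
    simp only [pdC_sum (dA _), this, Finset.sum_add_distrib]
    rw [Finset.sum_comm (f := fun i j => if k = i then (y j : ℂ) * pdC j (pdC k φ) y else 0)]
    simp only [Finset.sum_ite_eq, Finset.mem_univ, if_true]
    ring
  have h2 : pdC k (fun y : EuclideanSpace ℝ (Fin N) => ∑ i, (y i : ℂ) * pdC i φ y) y
      = pdC k φ y + ∑ i, (y i : ℂ) * pdC i (pdC k φ) y := by
    rw [pdC_sum dB]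
    simp only [pdC_mul (dc _) (d1 _), pdC_coord, Finset.sum_add_distrib, ite_mul, one_mul, zero_mul,
      Finset.sum_ite_eq, Finset.mem_univ, if_true, pdC_comm hφ k]
  rw [e, pdC_add ((Differentiable.fun_sum fun i _ => dA' i).fun_add ((differentiable_const _).fun_mul dB'))
    ((differentiable_const _).fun_mul d0),
    pdC_add (Differentiable.fun_sum fun i _ => dA' i) ((differentiable_const _).fun_mul dB'),
    pdC_mul (differentiable_const _) dB', pdC_mul (differentiable_const _) d0, h1, h2,
    pdC_const, pdC_const]
  unfold EqAB
  ring

/-! ### The two vector fields -/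

lemma fieldB_smooth {N : ℕ} {φ : EuclideanSpace ℝ (Fin N) → ℂ} (hφ : ContDiff ℝ (⊤ : ℕ∞) φ)
    (i : Fin N) : ContDiff ℝ (⊤ : ℕ∞) (fun y : EuclideanSpace ℝ (Fin N) =>
      (starRingEnd ℂ) (φ y) * (pdC i φ y - (y i : ℂ) * ∑ j, (y j : ℂ) * pdC j φ y)) :=
  (conj_smooth hφ).mul ((pdC_smooth hφ i).sub ((coord_smooth i).mul
    (ContDiff.sum fun j _ => (coord_smooth j).mul (pdC_smooth hφ j))))

lemma fieldC_smooth {N : ℕ} {φ : EuclideanSpace ℝ (Fin N) → ℂ} (hφ : ContDiff ℝ (⊤ : ℕ∞) φ)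
    (i : Fin N) : ContDiff ℝ (⊤ : ℕ∞) (fun y : EuclideanSpace ℝ (Fin N) =>
      (y i : ℂ) * ((starRingEnd ℂ) (φ y) * φ y)) :=
  (coord_smooth i).mul ((conj_smooth hφ).mul hφ)

lemma fieldC_div {N : ℕ} {φ : EuclideanSpace ℝ (Fin N) → ℂ} (hφ : ContDiff ℝ (⊤ : ℕ∞) φ)
    (y : EuclideanSpace ℝ (Fin N)) :
    ∑ i, pdC i (fun y : EuclideanSpace ℝ (Fin N) =>
      (y i : ℂ) * ((starRingEnd ℂ) (φ y) * φ y)) y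
    = N * ((starRingEnd ℂ) (φ y) * φ y)
      + (starRingEnd ℂ) (∑ i, (y i : ℂ) * pdC i φ y) * φ y
      + (starRingEnd ℂ) (φ y) * ∑ i, (y i : ℂ) * pdC i φ y := by
  have d0 := sm_diff hφ
  have dk := sm_diff (conj_smooth hφ)
  have dc : ∀ j, Differentiable ℝ (fun z : EuclideanSpace ℝ (Fin N) => ((z j : ℝ) : ℂ)) :=
    fun j => sm_diff (coord_smooth j)
  have : ∀ i, pdC i (fun y : EuclideanSpace ℝ (Fin N) =>
      (y i : ℂ) * ((starRingEnd ℂ) (φ y) * φ y)) y = ((starRingEnd ℂ) (φ y) * φ y)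
      + (starRingEnd ℂ) ((y i : ℂ) * pdC i φ y) * φ y
      + (starRingEnd ℂ) (φ y) * ((y i : ℂ) * pdC i φ y) := by
    intro i
    rw [pdC_mul (dc i) (dk.fun_mul d0), pdC_mul dk d0, pdC_coord, pdC_conj d0]
    simp
    ring
  simp only [this, Finset.sum_add_distrib, map_sum, Finset.mul_sum, Finset.sum_mul]
  simp

lemma fieldB_div {N : ℕ} {α β : ℂ} {φ : EuclideanSpace ℝ (Fin N) → ℂ}
    (hφ : ContDiff ℝ (⊤ : ℕ∞) φ) (y : EuclideanSpace ℝ (Fin N)) (heq : EqAB α β φ y = 0) :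
    ∑ i, pdC i (fun y : EuclideanSpace ℝ (Fin N) =>
      (starRingEnd ℂ) (φ y) * (pdC i φ y - (y i : ℂ) * ∑ j, (y j : ℂ) * pdC j φ y)) y
    = (∑ i, (starRingEnd ℂ) (pdC i φ y) * pdC i φ y)
      - (starRingEnd ℂ) (∑ i, (y i : ℂ) * pdC i φ y) * (∑ i, (y i : ℂ) * pdC i φ y)
      + (starRingEnd ℂ) (φ y) *
        ((α + β - N) * (∑ i, (y i : ℂ) * pdC i φ y) + α * β * φ y) := by
  have d0 := sm_diff hφ
  have dk := sm_diff (conj_smooth hφ)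
  have d1 : ∀ i, Differentiable ℝ (pdC i φ) := fun i => sm_diff (pdC_smooth hφ i)
  have dc : ∀ j, Differentiable ℝ (fun z : EuclideanSpace ℝ (Fin N) => ((z j : ℝ) : ℂ)) :=
    fun j => sm_diff (coord_smooth j)
  have dB : ∀ i : Fin N, Differentiable ℝ (fun y : EuclideanSpace ℝ (Fin N) =>
      (y i : ℂ) * pdC i φ y) := fun i => (dc i).fun_mul (d1 i)
  have dB' : Differentiable ℝ (fun y : EuclideanSpace ℝ (Fin N) =>
      ∑ i, (y i : ℂ) * pdC i φ y) := Differentiable.fun_sum fun i _ => dB i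
  have h2 : ∀ k, pdC k (fun y : EuclideanSpace ℝ (Fin N) => ∑ i, (y i : ℂ) * pdC i φ y) y
      = pdC k φ y + ∑ i, (y i : ℂ) * pdC k (pdC i φ) y := by
    intro k
    rw [pdC_sum dB]
    simp only [pdC_mul (dc _) (d1 _), pdC_coord, Finset.sum_add_distrib, ite_mul, one_mul, zero_mul,
      Finset.sum_ite_eq, Finset.mem_univ, if_true]
  set e := ∑ j, (y j : ℂ) * pdC j φ y with he
  have h3 : ∀ i, pdC i (fun y : EuclideanSpace ℝ (Fin N) =>
      (starRingEnd ℂ) (φ y) * (pdC i φ y - (y i : ℂ) * ∑ j, (y j : ℂ) * pdC j φ y)) y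
      = (starRingEnd ℂ) (pdC i φ y) * pdC i φ y - (starRingEnd ℂ) ((y i : ℂ) * pdC i φ y) * e
        - (starRingEnd ℂ) (φ y) * e - (starRingEnd ℂ) (φ y) * ((y i : ℂ) * pdC i φ y)
        - (starRingEnd ℂ) (φ y) * ∑ j,
          ((y i : ℂ) * (y j : ℂ) - if i = j then 1 else 0) * pdC i (pdC j φ) y := by
    intro i
    rw [pdC_mul dk ((d1 i).fun_sub ((dc i).fun_mul dB')), pdC_sub (d1 i) ((dc i).fun_mul dB'),
      pdC_mul (dc i) dB', pdC_conj d0, pdC_coord, h2, ← he]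
    simp only [sub_mul, Finset.sum_sub_distrib, ite_mul, one_mul, zero_mul,
      Finset.sum_ite_eq, Finset.mem_univ, if_true, map_mul, Complex.conj_ofReal, mul_assoc,
      ← Finset.mul_sum]
    ring
  have h4 : (∑ i, ∑ j, ((y i : ℂ) * (y j : ℂ) - if i = j then 1 else 0) * pdC i (pdC j φ) y)
      = -((α + β + 1) * e + α * β * φ y) := by
    unfold EqAB at heq
    linear_combination heq
  simp only [h3, Finset.sum_sub_distrib, ← Finset.mul_sum, ← Finset.sum_mul, ← map_sum, ← he, h4]
  simp
  ring

lemma fieldB_dot {N : ℕ} (φ : EuclideanSpace ℝ (Fin N) → ℂ) (y : EuclideanSpace ℝ (Fin N)) :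
    ∑ i, (y i : ℂ) * ((starRingEnd ℂ) (φ y) *
      (pdC i φ y - (y i : ℂ) * ∑ j, (y j : ℂ) * pdC j φ y))
    = ((1 - ‖y‖ ^ 2 : ℝ) : ℂ) * ((starRingEnd ℂ) (φ y) * ∑ i, (y i : ℂ) * pdC i φ y) := by
  set e := ∑ j, (y j : ℂ) * pdC j φ y with he
  have : ∀ i, (y i : ℂ) * ((starRingEnd ℂ) (φ y) * (pdC i φ y - (y i : ℂ) * e))
      = (starRingEnd ℂ) (φ y) * ((y i : ℂ) * pdC i φ y)
        - ((starRingEnd ℂ) (φ y) * e) * ((y i ^ 2 : ℝ) : ℂ) := by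
    intro i; push_cast; ring
  simp only [this, Finset.sum_sub_distrib, ← Finset.mul_sum, ← he]
  rw [sum_sq_eq]
  push_cast
  ring

lemma fieldC_dot {N : ℕ} (φ : EuclideanSpace ℝ (Fin N) → ℂ) (y : EuclideanSpace ℝ (Fin N)) :
    ∑ i, (y i : ℂ) * ((y i : ℂ) * ((starRingEnd ℂ) (φ y) * φ y))
    = ((‖y‖ ^ 2 : ℝ) : ℂ) * ((starRingEnd ℂ) (φ y) * φ y) := by
  rw [sum_sq_eq]
  push_cast
  rw [Finset.sum_mul]
  exact Finset.sum_congr rfl fun i _ => by ring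

/-! ### Uniqueness for large parameters -/

lemma uniq {N : ℕ} {α β : ℂ} (him : β.im = α.im) (ha : 0 < α.re) (hb : 0 < β.re)
    (hab : (N : ℝ) + 2 < α.re + β.re) {φ : EuclideanSpace ℝ (Fin N) → ℂ}
    (hφ : ContDiff ℝ (⊤ : ℕ∞) φ)
    (heq : ∀ y : EuclideanSpace ℝ (Fin N), ‖y‖ < 1 → EqAB α β φ y = 0)
    (y : EuclideanSpace ℝ (Fin N)) (hy : ‖y‖ < 1) : φ y = 0 := by
  obtain ⟨γ, hγ⟩ : ∃ γ : ℝ, γ = (α.re + β.re - N) / 2 := ⟨_, rfl⟩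
  have hγ1 : 1 < γ := by rw [hγ]; linarith
  have hconj : ∀ z : ℂ, (starRingEnd ℂ) z * z = ((Complex.normSq z : ℝ) : ℂ) := fun z => by
    rw [mul_comm, Complex.mul_conj]
  have h1le : (1 : WithTop ℕ∞) ≤ ((⊤ : ℕ∞) : WithTop ℕ∞) :=
    WithTop.coe_le_coe.2 (le_top : (1 : ℕ∞) ≤ ⊤)
  have hG : ∀ z : EuclideanSpace ℝ (Fin N),
      (∑ i, (starRingEnd ℂ) (pdC i φ z) * pdC i φ z)
      - (starRingEnd ℂ) (∑ i, (z i : ℂ) * pdC i φ z) * (∑ i, (z i : ℂ) * pdC i φ z)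
      = (((∑ i, Complex.normSq (pdC i φ z))
          - Complex.normSq (∑ i, (z i : ℂ) * pdC i φ z) : ℝ) : ℂ) := by
    intro z
    simp only [hconj]
    push_cast
    ring
  by_cases hτ : α.im = 0
  · have key : ∀ z : EuclideanSpace ℝ (Fin N), ‖z‖ < 1 →
        (((1 - ‖z‖ ^ 2 : ℝ) : ℂ) * ∑ i, pdC i (fun y : EuclideanSpace ℝ (Fin N) =>
          (starRingEnd ℂ) (φ y) * (pdC i φ y - (y i : ℂ) * ∑ j, (y j : ℂ) * pdC j φ y)) z
        - ((2 * γ : ℝ) : ℂ) * ∑ i, (z i : ℂ) * ((starRingEnd ℂ) (φ z) *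
          (pdC i φ z - (z i : ℂ) * ∑ j, (z j : ℂ) * pdC j φ z))).re
        = (1 - ‖z‖ ^ 2) * (((∑ i, Complex.normSq (pdC i φ z))
          - Complex.normSq (∑ i, (z i : ℂ) * pdC i φ z))
          + α.re * β.re * Complex.normSq (φ z)) := by
      intro z hz
      rw [fieldB_div hφ z (heq z hz), fieldB_dot, hG]
      generalize ∑ i, (z i : ℂ) * pdC i φ z = e
      generalize ∑ i, Complex.normSq (pdC i φ z) = g
      simp only [Complex.sub_re, Complex.add_re, Complex.mul_re, Complex.ofReal_re,
        Complex.ofReal_im, Complex.add_im, Complex.sub_im, Complex.mul_im, Complex.conj_re,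
        Complex.conj_im, Complex.normSq_apply, Complex.natCast_re, Complex.natCast_im, him, hτ, hγ]
      ring
    have cs : ∀ z : EuclideanSpace ℝ (Fin N), ‖z‖ < 1 →
        Complex.normSq (∑ i, (z i : ℂ) * pdC i φ z) ≤ ∑ i, Complex.normSq (pdC i φ z) := by
      intro z hz
      have h1 : ‖∑ i, (z i : ℂ) * pdC i φ z‖ ≤ ∑ i, |z i| * ‖pdC i φ z‖ := by
        refine (norm_sum_le _ _).trans (le_of_eq ?_)
        exact Finset.sum_congr rfl fun i _ => by simp
      have h2 := Finset.sum_mul_sq_le_sq_mul_sq Finset.univ (fun i => |z i|) (fun i => ‖pdC i φ z‖)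
      simp only [sq_abs, ← sum_sq_eq] at h2
      simp only [Complex.normSq_eq_norm_sq]
      have h3 : 0 ≤ ∑ i, ‖pdC i φ z‖ ^ 2 := Finset.sum_nonneg fun i _ => sq_nonneg _
      have h4 : ‖z‖ ^ 2 ≤ 1 := by nlinarith [norm_nonneg z]
      calc _ ≤ (∑ i, |z i| * ‖pdC i φ z‖) ^ 2 := by gcongr
        _ ≤ _ := h2
        _ ≤ 1 * _ := mul_le_mul_of_nonneg_right h4 h3
        _ = _ := one_mul _
    have hp : ∀ z : EuclideanSpace ℝ (Fin N), ‖z‖ < 1 → 0 < 1 - ‖z‖ ^ 2 := by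
      intro z hz; nlinarith [norm_nonneg z]
    have hmul : ∀ z, 0 ≤ α.re * β.re * Complex.normSq (φ z) := fun z =>
      mul_nonneg (mul_pos ha hb).le (Complex.normSq_nonneg _)
    have := weighted_div hγ1 _ (fun i => (fieldB_smooth hφ i).of_le h1le) (by
      intro z hz
      rw [key z hz]
      exact mul_nonneg (hp z hz).le (add_nonneg (sub_nonneg.2 (cs z hz)) (hmul z))) y hy
    rw [key y hy] at this
    have h5 := (mul_eq_zero.1 this).resolve_left (hp y hy).ne'
    have h6 : α.re * β.re * Complex.normSq (φ y) = 0 := by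
      linarith [cs y hy, hmul y]
    exact Complex.normSq_eq_zero.1 ((mul_eq_zero.1 h6).resolve_left (mul_pos ha hb).ne')
  · obtain ⟨c, hcr, hci⟩ : ∃ c : ℂ, c.re = 0 ∧ c.im = -1 / α.im := ⟨⟨0, -1 / α.im⟩, rfl, rfl⟩
    have key : ∀ z : EuclideanSpace ℝ (Fin N), ‖z‖ < 1 →
        (((1 - ‖z‖ ^ 2 : ℝ) : ℂ) * ∑ i, pdC i (fun y : EuclideanSpace ℝ (Fin N) =>
          c * ((starRingEnd ℂ) (φ y) * (pdC i φ y - (y i : ℂ) * ∑ j, (y j : ℂ) * pdC j φ y))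
          - (y i : ℂ) * ((starRingEnd ℂ) (φ y) * φ y)) z
        - ((2 * γ : ℝ) : ℂ) * ∑ i, (z i : ℂ) * (c * ((starRingEnd ℂ) (φ z) *
          (pdC i φ z - (z i : ℂ) * ∑ j, (z j : ℂ) * pdC j φ z))
          - (z i : ℂ) * ((starRingEnd ℂ) (φ z) * φ z))).re
        = 2 * γ * Complex.normSq (φ z) := by
      intro z hz
      have e1 : ∑ i, pdC i (fun y : EuclideanSpace ℝ (Fin N) =>
          c * ((starRingEnd ℂ) (φ y) * (pdC i φ y - (y i : ℂ) * ∑ j, (y j : ℂ) * pdC j φ y))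
          - (y i : ℂ) * ((starRingEnd ℂ) (φ y) * φ y)) z
          = c * (∑ i, pdC i (fun y : EuclideanSpace ℝ (Fin N) =>
          (starRingEnd ℂ) (φ y) * (pdC i φ y - (y i : ℂ) * ∑ j, (y j : ℂ) * pdC j φ y)) z)
          - ∑ i, pdC i (fun y : EuclideanSpace ℝ (Fin N) =>
            (y i : ℂ) * ((starRingEnd ℂ) (φ y) * φ y)) z := by
        rw [Finset.mul_sum, ← Finset.sum_sub_distrib]
        refine Finset.sum_congr rfl fun i _ => ?_
        rw [pdC_sub ((differentiable_const c).fun_mul (sm_diff (fieldB_smooth hφ i)))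
          (sm_diff (fieldC_smooth hφ i)),
          pdC_mul (differentiable_const c) (sm_diff (fieldB_smooth hφ i)), pdC_const]
        ring
      have e2 : ∑ i, (z i : ℂ) * (c * ((starRingEnd ℂ) (φ z) *
          (pdC i φ z - (z i : ℂ) * ∑ j, (z j : ℂ) * pdC j φ z))
          - (z i : ℂ) * ((starRingEnd ℂ) (φ z) * φ z))
          = c * (∑ i, (z i : ℂ) * ((starRingEnd ℂ) (φ z) *
          (pdC i φ z - (z i : ℂ) * ∑ j, (z j : ℂ) * pdC j φ z)))
          - ∑ i, (z i : ℂ) * ((z i : ℂ) * ((starRingEnd ℂ) (φ z) * φ z)) := by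
        rw [Finset.mul_sum, ← Finset.sum_sub_distrib]
        exact Finset.sum_congr rfl fun i _ => by ring
      rw [e1, e2, fieldB_div hφ z (heq z hz), fieldB_dot, fieldC_div hφ, fieldC_dot, hG]
      generalize ∑ i, (z i : ℂ) * pdC i φ z = e
      generalize ∑ i, Complex.normSq (pdC i φ z) = g
      simp only [Complex.sub_re, Complex.add_re, Complex.mul_re, Complex.ofReal_re,
        Complex.ofReal_im, Complex.add_im, Complex.sub_im, Complex.mul_im, Complex.conj_re,
        Complex.conj_im, Complex.normSq_apply, Complex.natCast_re, Complex.natCast_im, him, hcr,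
        hci, hγ]
      field_simp
      ring
    have := weighted_div hγ1 (fun i y => c * ((starRingEnd ℂ) (φ y) *
        (pdC i φ y - (y i : ℂ) * ∑ j, (y j : ℂ) * pdC j φ y))
          - (y i : ℂ) * ((starRingEnd ℂ) (φ y) * φ y))
      (fun i => ((contDiff_const.mul (fieldB_smooth hφ i)).sub (fieldC_smooth hφ i)).of_le h1le) (by
      intro z hz
      rw [key z hz]
      exact mul_nonneg (by linarith) (Complex.normSq_nonneg _)) y hy
    rw [key y hy] at this
    exact Complex.normSq_eq_zero.1 ((mul_eq_zero.1 this).resolve_left (by linarith))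

lemma modes {N : ℕ} (k : ℕ) : ∀ (α β : ℂ) (φ : EuclideanSpace ℝ (Fin N) → ℂ),
    β.im = α.im → 0 < α.re + k → 0 < β.re + k → (N : ℝ) + 2 < α.re + β.re + 2 * k →
    ContDiff ℝ (⊤ : ℕ∞) φ →
    (∀ y : EuclideanSpace ℝ (Fin N), ‖y‖ < 1 → EqAB α β φ y = 0) →
    (∃ y : EuclideanSpace ℝ (Fin N), ‖y‖ < 1 ∧ φ y ≠ 0) →
    ∃ n : ℕ, α + n = 0 ∨ β + n = 0 := by
  induction k with
  | zero =>
    rintro α β φ him ha hb hab hφ heq ⟨y, hy, hne⟩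
    refine absurd (uniq him ?_ ?_ ?_ hφ heq y hy) hne <;> simp_all
  | succ k ih =>
    rintro α β φ him ha hb hab hφ heq ⟨y, hy, hne⟩
    push_cast at ha hb hab
    have hop : IsOpen {z : EuclideanSpace ℝ (Fin N) | ‖z‖ < 1} :=
      isOpen_lt continuous_norm continuous_const
    by_cases h : ∃ i : Fin N, ∃ z : EuclideanSpace ℝ (Fin N), ‖z‖ < 1 ∧ pdC i φ z ≠ 0
    · obtain ⟨i, hi⟩ := h
      obtain ⟨n, hn⟩ := ih (α + 1) (β + 1) (pdC i φ) (by simpa using him)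
        (by simp; linarith) (by simp; linarith) (by simp; linarith) (pdC_smooth hφ i) (by
          intro z hz
          rw [← EqAB_deriv hφ i z]
          have : EqAB α β φ =ᶠ[nhds z] fun _ => 0 := by
            filter_upwards [hop.mem_nhds hz] with x hx using heq x hx
          rw [(pdC_congr this i).eq_of_nhds, pdC_const]) hi
      refine ⟨n + 1, ?_⟩
      push_cast
      rcases hn with hn | hn
      · left; linear_combination hn
      · right; linear_combination hn
    · push Not at h
      have h2 : ∀ i j, pdC i (pdC j φ) y = 0 := by
        intro i j
        have : pdC j φ =ᶠ[nhds y] fun _ => 0 := by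
          filter_upwards [hop.mem_nhds hy] with x hx using h j x hx
        rw [(pdC_congr this i).eq_of_nhds, pdC_const]
      have h3 := heq y hy
      unfold EqAB at h3
      simp only [h2, h _ y hy, mul_zero, Finset.sum_const_zero, add_zero, zero_add] at h3
      refine ⟨0, ?_⟩
      simpa [hne] using h3

lemma exists_global {N : ℕ} {φ : EuclideanSpace ℝ (Fin N) → ℂ}
    {Ω : Set (EuclideanSpace ℝ (Fin N))} (hΩ : IsOpen Ω) (hsub : Metric.closedBall 0 1 ⊆ Ω)
    (hφ : ContDiffOn ℝ (⊤ : ℕ∞) φ Ω) :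
    ∃ ψ : EuclideanSpace ℝ (Fin N) → ℂ, ContDiff ℝ (⊤ : ℕ∞) ψ ∧
      ∀ y ∈ Metric.closedBall (0 : EuclideanSpace ℝ (Fin N)) 1, ψ =ᶠ[nhds y] φ := by
  obtain ⟨f, h0, h1, -⟩ := exists_contMDiffMap_zero_one_nhds_of_isClosed
    (n := (⊤ : ℕ∞)) (modelWithCornersSelf ℝ (EuclideanSpace ℝ (Fin N))) hΩ.isClosed_compl
    (Metric.isClosed_closedBall (x := (0 : EuclideanSpace ℝ (Fin N))) (ε := 1))
    (by rw [Set.disjoint_compl_left_iff_subset]; exact hsub)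
  have hf : ContDiff ℝ (⊤ : ℕ∞) f := f.contMDiff.contDiff
  refine ⟨fun y => f y • φ y, ?_, ?_⟩
  · rw [contDiff_iff_contDiffAt]
    intro y
    by_cases hy : y ∈ Ω
    · exact hf.contDiffAt.smul (hφ.contDiffAt (hΩ.mem_nhds hy))
    · have : (fun y => f y • φ y) =ᶠ[nhds y] fun _ => 0 := by
        filter_upwards [(eventually_nhdsSet_iff_forall.1 h0) y hy] with z hz
        simp [hz]
      exact contDiffAt_const.congr_of_eventuallyEq this
  · intro y hy
    filter_upwards [(eventually_nhdsSet_iff_forall.1 h1) y hy] with z hz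
    simp [hz]

/-- Mode stability of the ODE blow-up profile `κ₀`: every eigenvalue `λ` of the
linearized operator around `κ₀` with `Re λ > −1` equals `0` or `1`. -/
theorem mode_stability_kappa0 (N : ℕ) (hN : 1 ≤ N) (p : ℝ) (hp : 1 < p) (lam : ℂ)
    (hev : IsEigenvalue N p (0 : EuclideanSpace ℝ (Fin N)) lam)
    (hre : -1 < lam.re) :
    lam = 0 ∨ lam = 1 := by
  obtain ⟨φ, Ω, hΩ, hsub, hφ, heq, y₀, hy₀, hne⟩ := hev
  obtain ⟨ψ, hψ, hψφ⟩ := exists_global hΩ hsub hφ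
  have hp1 : p - 1 ≠ 0 := by linarith
  have hp1' : 0 < p - 1 := by linarith
  have hk : ∀ y : EuclideanSpace ℝ (Fin N), kd p 0 y ^ (p - 1) = 2 * (p + 1) / (p - 1) ^ 2 := by
    intro y
    have : kd p 0 y = kappa0 p := by simp [kd]
    rw [this, kappa0, ← Real.rpow_mul (by positivity), one_div_mul_cancel hp1, Real.rpow_one]
  obtain ⟨s, hs⟩ : ∃ s : ℝ, s = 2 / (p - 1) := ⟨_, rfl⟩
  have hs0 : 0 < s := by rw [hs]; positivity
  have hps : p = 1 + 2 / s := by rw [hs]; field_simp; ring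
  have c1 : (p + 3) / (p - 1) = 2 * s + 1 := by rw [hs]; field_simp; ring
  have c2 : 2 * (p + 1) / (p - 1) ^ 2 = s * (s + 1) := by rw [hs]; field_simp; ring
  have c3 : 2 * (p + 1) / (p - 1) = 2 * (s + 1) := by rw [hs]; field_simp; ring
  have c4 : p * (s * (s + 1)) = (s + 1) * (s + 2) := by rw [hps]; field_simp
  have hE : ∀ y : EuclideanSpace ℝ (Fin N), ‖y‖ < 1 →
      EqAB (lam - 1) (lam + ((2 * s + 2 : ℝ) : ℂ)) ψ y = 0 := by
    intro y hy
    have hyc : y ∈ Metric.closedBall (0 : EuclideanSpace ℝ (Fin N)) 1 := by simpa using hy.le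
    have h := heq y hyc
    have e0 := (hψφ y hyc).eq_of_nhds
    have e1 : ∀ i, pdC i ψ y = pdC i φ y := fun i => (pdC_congr (hψφ y hyc) i).eq_of_nhds
    have e2 : ∀ i j, pdC i (pdC j ψ) y = pdC i (pdC j φ) y := fun i j =>
      (pdC_congr (pdC_congr (hψφ y hyc) j) i).eq_of_nhds
    unfold EigenEqAt at h
    rw [hk, c1, c2, c3, c4] at h
    unfold EqAB
    simp only [e0, e1, e2]
    have e3 : ∀ i j : Fin N, (((y i * y j - if i = j then (1 : ℝ) else 0) : ℝ) : ℂ)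
        = (y i : ℂ) * (y j : ℂ) - if i = j then 1 else 0 := by
      intro i j
      split_ifs <;> push_cast <;> rfl
    simp only [e3] at h
    push_cast at h ⊢
    linear_combination h
  have hnz : ∃ y : EuclideanSpace ℝ (Fin N), ‖y‖ < 1 ∧ ψ y ≠ 0 := by
    by_contra hcon
    push Not at hcon
    have hcl : y₀ ∈ closure (Metric.ball (0 : EuclideanSpace ℝ (Fin N)) 1) := by
      rw [closure_ball _ one_ne_zero]; exact hy₀
    have hz : ψ y₀ = 0 := by
      have hclosed : IsClosed {z | ψ z = 0} := isClosed_eq hψ.continuous continuous_const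
      exact closure_minimal (fun z hz => hcon z (by simpa using hz)) hclosed hcl
    exact hne (by rw [← (hψφ y₀ hy₀).eq_of_nhds, hz])
  obtain ⟨n, hn⟩ := modes (N + 4) _ _ ψ (by simp) (by simp; linarith)
    (by simp; linarith) (by simp; linarith) hψ hE hnz
  rcases hn with hn | hn
  · have hre' := congrArg Complex.re hn
    simp at hre'
    have hlt : (n : ℝ) < 2 := by linarith
    have hlt' : n < 2 := by exact_mod_cast hlt
    interval_cases n
    · right
      push_cast at hn
      linear_combination hn
    · left
      push_cast at hn
      linear_combination hn
  · exfalso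
    have hre' := congrArg Complex.re hn
    simp at hre'
    have : (0 : ℝ) ≤ n := Nat.cast_nonneg n
    linarith

end
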